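/- Let c and d be positive integers, and let G be a finite group that can be generated by d elements and satisfies maol(G) ≤ c. Then log|G| ≤ 1.01624·d·(A(c,d)+1)·(log A(c,d)/log 2 + 1) + (1/2)·(7 + log c)·log c, where A(c,d) := c^(d + (1/2)·(7 + log c)·( binom(d,2) + (d/(2·log 2))·(7 + log c)·log c )) and log denotes the natural logarithm. -/

import Mathlib

/-- `maol G` is the maximum length of an orbit of the natural action of `Aut(G)` on `G`. -/
noncomputable def maol (G : Type*) [Group G] : ℕ :=
  ⨆ g : G, Nat.card (MulAction.orbit (MulAut G) g)

theorem Nat.card_divisors_le_two_mul_sqrt (n : ℕ) : n.divisors.card ≤ 2 * n.sqrt := by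
  have hsub : n.divisors ⊆
      Finset.Icc 1 n.sqrt ∪ (Finset.Icc 1 n.sqrt).image (fun d => n / d) := by
    intro d hd
    obtain ⟨hdn, hn⟩ := Nat.mem_divisors.1 hd
    obtain ⟨e, rfl⟩ := hdn
    have hd0 : 0 < d := Nat.pos_of_ne_zero (left_ne_zero_of_mul hn)
    have he0 : 0 < e := Nat.pos_of_ne_zero (right_ne_zero_of_mul hn)
    rw [Finset.mem_union, Finset.mem_image]
    rcases le_total d e with h | h
    · exact Or.inl (Finset.mem_Icc.2 ⟨hd0, Nat.le_sqrt.2 (Nat.mul_le_mul_left d h)⟩)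
    · exact Or.inr ⟨e, Finset.mem_Icc.2 ⟨he0, Nat.le_sqrt.2 (Nat.mul_le_mul_right e h)⟩,
        Nat.mul_div_cancel d he0⟩
  calc n.divisors.card ≤ _ := Finset.card_le_card hsub
    _ ≤ _ := Finset.card_union_le _ _
    _ ≤ n.sqrt + n.sqrt := by
      refine Nat.add_le_add (by simp) (Finset.card_image_le.trans (by simp))
    _ = 2 * n.sqrt := by ring

theorem Nat.le_four_mul_totient_sq (n : ℕ) : n ≤ 4 * n.totient ^ 2 := by
  rcases Nat.eq_zero_or_pos n with rfl | hn
  · simp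
  have hsum : n ≤ n.divisors.card * n.totient := by
    conv_lhs => rw [← Nat.sum_totient n]
    rw [← smul_eq_mul]
    refine Finset.sum_le_card_nsmul _ _ _ fun d hd => ?_
    exact Nat.le_of_dvd (Nat.totient_pos.2 hn)
      (Nat.totient_dvd_of_dvd (Nat.dvd_of_mem_divisors hd))
  have h : n ≤ 2 * n.sqrt * n.totient :=
    hsum.trans (Nat.mul_le_mul_right _ n.card_divisors_le_two_mul_sqrt)
  refine Nat.le_of_mul_le_mul_left ?_ hn
  calc n * n ≤ (2 * n.sqrt * n.totient) * (2 * n.sqrt * n.totient) := Nat.mul_le_mul h h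
    _ = (n.sqrt * n.sqrt) * (4 * n.totient ^ 2) := by ring
    _ ≤ n * (4 * n.totient ^ 2) := Nat.mul_le_mul_right _ n.sqrt_le

/-- The number of units of `ZMod (m * n)` lying over `1` in `ZMod m` is at least `φ n`. -/
theorem ZMod.totient_le_card_ker_unitsMap (m n : ℕ) [NeZero m] [NeZero n] :
    n.totient ≤ Nat.card (ZMod.unitsMap (Nat.dvd_mul_right m n)).ker := by
  set f := ZMod.unitsMap (Nat.dvd_mul_right m n)
  have h1 : Nat.card f.ker * Nat.card f.range = (m * n).totient := by
    rw [← Subgroup.index_ker, Subgroup.card_mul_index, Nat.card_eq_fintype_card,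
      ZMod.card_units_eq_totient]
  have h2 : Nat.card f.range ≤ m.totient := by
    rw [← ZMod.card_units_eq_totient m, ← Nat.card_eq_fintype_card]
    exact Subgroup.card_le_card_group _
  refine Nat.le_of_mul_le_mul_right ?_ (Nat.totient_pos.2 (NeZero.pos m))
  calc n.totient * m.totient = m.totient * n.totient := mul_comm _ _
    _ ≤ (m * n).totient := Nat.totient_super_multiplicative m n
    _ = Nat.card f.ker * Nat.card f.range := h1.symm
    _ ≤ Nat.card f.ker * m.totient := Nat.mul_le_mul_left _ h2

section FiniteGroup

open scoped IsMulCommutative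

variable {G : Type*} [Group G] [Finite G]

theorem card_orbit_mulAut_le_maol (g : G) : Nat.card (MulAction.orbit (MulAut G) g) ≤ maol G :=
  le_ciSup (f := fun g : G => Nat.card (MulAction.orbit (MulAut G) g))
    (Set.finite_range _).bddAbove g

/-- By the transfer into the center, `x ↦ x ^ r` is multiplicative when `r ≡ 1` modulo the
index of the center. -/
theorem mul_pow_of_modEq_index_center {r : ℕ} (hr : r ≡ 1 [MOD (Subgroup.center G).index])
    (x y : G) : (x * y) ^ r = x ^ r * y ^ r := by
  obtain ⟨t, ht⟩ := (Nat.modEq_iff_dvd.1 hr.symm)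
  have hrt : (r : ℤ) = 1 + (Subgroup.center G).index * t := by push_cast at ht; linarith
  have key (z : G) : z ^ r = z * ((MonoidHom.transferCenterPow G z ^ t : Subgroup.center G) : G) := by
    rw [Subgroup.coe_zpow, MonoidHom.transferCenterPow_apply, ← zpow_natCast z r, hrt, zpow_add,
      zpow_one, zpow_mul, zpow_natCast]
  have hc := Subgroup.mem_center_iff.1 (MonoidHom.transferCenterPow G x ^ t).2 y
  have hmul : (MonoidHom.transferCenterPow G x * MonoidHom.transferCenterPow G y) ^ t =
      MonoidHom.transferCenterPow G x ^ t * MonoidHom.transferCenterPow G y ^ t :=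
    Commute.mul_zpow (mul_comm' _ _) t
  rw [key, key, key, map_mul, hmul, Subgroup.coe_mul, mul_assoc, mul_assoc, ← mul_assoc y,
    hc, mul_assoc]

theorem pow_mem_orbit_mulAut {r : ℕ} (hr : r ≡ 1 [MOD (Subgroup.center G).index])
    (hcop : (Nat.card G).Coprime r) (g : G) : g ^ r ∈ MulAction.orbit (MulAut G) g := by
  let e : MulAut G :=
    { powCoprime hcop with map_mul' := fun x y => mul_pow_of_modEq_index_center hr x y }
  exact MulAction.mem_orbit_iff.2 ⟨e, rfl⟩

theorem card_dvd_index_center_mul_exponent_pow : Nat.card G ∣ (Subgroup.center G).index *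
    Monoid.exponent (Subgroup.center G) ^ Group.rank (Subgroup.center G) := by
  rw [← (Subgroup.center G).card_mul_index, mul_comm]
  exact mul_dvd_mul_left _ (card_dvd_exponent_pow_rank _)

theorem totient_exponent_center_le :
    (Monoid.exponent (Subgroup.center G)).totient ≤ maol G * (Subgroup.center G).index := by
  set m := (Subgroup.center G).index with hm
  set n := Monoid.exponent (Subgroup.center G)
  have : NeZero m := ⟨Subgroup.index_ne_zero_of_finite⟩
  have : NeZero n := ⟨Monoid.exponent_ne_zero_of_finite⟩
  obtain ⟨z, hz⟩ := Monoid.exists_orderOf_eq_exponent (G := Subgroup.center G)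
    Monoid.ExponentExists.of_finite
  have hzn : orderOf (z : G) = n := by rw [Subgroup.orderOf_coe, hz]
  let K := (ZMod.unitsMap (Nat.dvd_mul_right m n)).ker
  have hmem (u : K) : (z : G) ^ (u : (ZMod (m * n))ˣ).val.val ∈
      MulAction.orbit (MulAut G) (z : G) := by
    have hcop := ZMod.val_coe_unit_coprime (u : (ZMod (m * n))ˣ)
    refine pow_mem_orbit_mulAut ?_ ?_ _
    · have h := congrArg Units.val (MonoidHom.mem_ker.1 u.2)
      rw [← ZMod.natCast_eq_natCast_iff]
      rw [ZMod.unitsMap_def, Units.coe_map, Units.val_one] at h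
      rw [Nat.cast_one, ← hm, ← h]
      simp [ZMod.castHom_apply, ZMod.natCast_val]
    · rw [Nat.coprime_mul_iff_right] at hcop
      exact ((hcop.1.mul_right (hcop.2.pow_right _)).symm).coprime_dvd_left
        card_dvd_index_center_mul_exponent_pow
  let F : K → MulAction.orbit (MulAut G) (z : G) × Fin m := fun u =>
    (⟨_, hmem u⟩, ⟨(u : (ZMod (m * n))ˣ).val.val / n,
      Nat.div_lt_of_lt_mul ((ZMod.val_lt _).trans_eq (mul_comm m n))⟩)
  have hF : Function.Injective F := by
    intro u v huv
    obtain ⟨h1, h2⟩ := Prod.ext_iff.1 huv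
    have h1' := Subtype.ext_iff.1 h1
    have h2' := Fin.ext_iff.1 h2
    have h1'' := pow_inj_mod.1 h1'
    rw [hzn] at h1''
    refine Subtype.ext (Units.ext (ZMod.val_injective _ ?_))
    rw [← Nat.div_add_mod (u : (ZMod (m * n))ˣ).val.val n, h1'']
    exact (congrArg (fun q => n * q + _) h2').trans (Nat.div_add_mod _ _)
  calc n.totient ≤ Nat.card K := ZMod.totient_le_card_ker_unitsMap m n
    _ ≤ _ := Nat.card_le_card_of_injective F hF
    _ = Nat.card (MulAction.orbit (MulAut G) (z : G)) * m := by simp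
    _ ≤ maol G * m := Nat.mul_le_mul_right _ (card_orbit_mulAut_le_maol _)

theorem index_center_le_maol_pow {S : Finset G} (hS : Subgroup.closure (S : Set G) = ⊤) :
    (Subgroup.center G).index ≤ maol G ^ S.card := by
  let F : G ⧸ Subgroup.center G → ∀ s : S, MulAction.orbit (MulAut G) (s : G) :=
    fun x s => ⟨MulAut.conj x.out s, MulAut.conj x.out, rfl⟩
  have hF : Function.Injective F := by
    intro x y hxy
    have hconj (s : G) (hs : s ∈ S) : x.out * s * x.out⁻¹ = y.out * s * y.out⁻¹ :=
      Subtype.ext_iff.1 (congrFun hxy ⟨s, hs⟩)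
    have hcent : x.out⁻¹ * y.out ∈ Subgroup.center G := by
      have hcenter : Subgroup.center G = Subgroup.centralizer (S : Set G) := by
        rw [← Subgroup.centralizer_univ, ← Subgroup.coe_top, ← hS, Subgroup.centralizer_closure]
      refine hcenter.symm.le (Subgroup.mem_centralizer_iff.2 fun s hs => ?_)
      have h := hconj s hs
      calc s * (x.out⁻¹ * y.out) = x.out⁻¹ * (x.out * s * x.out⁻¹) * y.out := by group
        _ = x.out⁻¹ * (y.out * s * y.out⁻¹) * y.out := by rw [h]
        _ = x.out⁻¹ * y.out * s := by group
    rw [← Quotient.out_eq' x, ← Quotient.out_eq' y]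
    exact QuotientGroup.eq.2 hcent
  calc (Subgroup.center G).index ≤ _ := Nat.card_le_card_of_injective F hF
    _ = ∏ s : S, Nat.card (MulAction.orbit (MulAut G) (s : G)) := Nat.card_pi
    _ ≤ ∏ _s : S, maol G := Finset.prod_le_prod' fun s _ => card_orbit_mulAut_le_maol _
    _ = maol G ^ S.card := by simp

/-- Multiplicative form of the bound: `|G|` in terms of the orbit bound, the number of generators,
and the index of the center. -/
theorem card_le_of_maol_le {c d : ℕ} {S : Finset G} (hSd : S.card ≤ d)
    (hS : Subgroup.closure (S : Set G) = ⊤) (hc : maol G ≤ c) :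
    Nat.card G ≤ (Subgroup.center G).index *
      (4 * (c * (Subgroup.center G).index) ^ 2) ^ ((Subgroup.center G).index * d) := by
  set m := (Subgroup.center G).index
  have hm0 : m ≠ 0 := Subgroup.index_ne_zero_of_finite
  have hn0 : 0 < Monoid.exponent (Subgroup.center G) :=
    Nat.pos_of_ne_zero Monoid.exponent_ne_zero_of_finite
  have hrank : Group.rank (Subgroup.center G) ≤ m * d :=
    (Subgroup.rank_le_index_mul_rank _).trans
      (Nat.mul_le_mul_left _ ((Group.rank_le hS).trans hSd))
  have hexp : Monoid.exponent (Subgroup.center G) ≤ 4 * (c * m) ^ 2 :=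
    (Nat.le_four_mul_totient_sq _).trans (Nat.mul_le_mul_left _ (Nat.pow_le_pow_left
      (totient_exponent_center_le.trans (Nat.mul_le_mul_right _ hc)) 2))
  calc Nat.card G ≤ m * Monoid.exponent (Subgroup.center G) ^ Group.rank (Subgroup.center G) :=
        Nat.le_of_dvd (Nat.mul_pos (Nat.pos_of_ne_zero hm0) (pow_pos hn0 _))
          card_dvd_index_center_mul_exponent_pow
    _ ≤ m * (4 * (c * m) ^ 2) ^ (m * d) :=
        Nat.mul_le_mul_left _ ((Nat.pow_le_pow_left hexp _).trans
          (Nat.pow_le_pow_right (hn0.trans_le hexp) hrank))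

end FiniteGroup


theorem stmt_2 (c d : ℕ) (hc : 0 < c) (hd : 0 < d)
    (G : Type*) [Group G] [Finite G]
    (hgen : ∃ S : Finset G, S.card ≤ d ∧ Subgroup.closure (S : Set G) = ⊤)
    (hmaol : maol G ≤ c) :
    Real.log (Nat.card G) ≤
      1.01624 * d *
          ((c : ℝ) ^ ((d : ℝ) + (1 / 2) * (7 + Real.log c) *
                ((d.choose 2 : ℝ) + ((d : ℝ) / (2 * Real.log 2)) * (7 + Real.log c) * Real.log c)
              : ℝ) + 1) *
          (Real.log ((c : ℝ) ^ ((d : ℝ) + (1 / 2) * (7 + Real.log c) *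
                ((d.choose 2 : ℝ) + ((d : ℝ) / (2 * Real.log 2)) * (7 + Real.log c) * Real.log c))) /
              Real.log 2 + 1) +
        (1 / 2) * (7 + Real.log c) * Real.log c := by
  obtain ⟨S, hSd, hS⟩ := hgen
  have hcard := card_le_of_maol_le hSd hS hmaol
  have hm0 : 0 < (Subgroup.center G).index := Nat.pos_of_ne_zero Subgroup.index_ne_zero_of_finite
  have hmc : (Subgroup.center G).index ≤ c ^ d :=
    (index_center_le_maol_pow hS).trans ((Nat.pow_le_pow_left hmaol _).trans
      (Nat.pow_le_pow_right hc hSd))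
  generalize (Subgroup.center G).index = m at hcard hm0 hmc
  set E : ℝ := (d : ℝ) + (1 / 2) * (7 + Real.log c) *
    ((d.choose 2 : ℝ) + ((d : ℝ) / (2 * Real.log 2)) * (7 + Real.log c) * Real.log c) with hE
  set A : ℝ := (c : ℝ) ^ E with hA
  have hc1 : (1 : ℝ) ≤ c := by exact_mod_cast hc
  have hd1 : (1 : ℝ) ≤ d := by exact_mod_cast hd
  have hm1 : (1 : ℝ) ≤ m := by exact_mod_cast hm0
  have hl0 : 0 ≤ Real.log c := Real.log_nonneg hc1
  have hlm0 : 0 ≤ Real.log m := Real.log_nonneg hm1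
  have hmc' : (m : ℝ) ≤ (c : ℝ) ^ d := by exact_mod_cast hmc
  have hlm : Real.log m ≤ d * Real.log c := by
    rw [← Real.log_pow]; exact Real.log_le_log (by positivity) hmc'
  have h2pos : 0 < Real.log 2 := Real.log_pos one_lt_two
  have h2lt := Real.log_two_lt_d9
  have h2gt := Real.log_two_gt_d9
  have hlog4 : Real.log 4 = 2 * Real.log 2 := by
    rw [show (4 : ℝ) = 2 ^ 2 by norm_num, Real.log_pow]; norm_num
  have hEd : (d : ℝ) ≤ E := by
    rw [hE]; exact le_add_of_nonneg_right (by positivity)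
  have hmA : (m : ℝ) ≤ A := by
    refine hmc'.trans ?_
    rw [hA, ← Real.rpow_natCast]
    exact Real.rpow_le_rpow_of_exponent_le hc1 hEd
  have hlA : Real.log A = E * Real.log c := Real.log_rpow (by linarith) E
  have hA1 : 1 ≤ A := hm1.trans hmA
  have hlA0 : 0 ≤ Real.log A := Real.log_nonneg hA1
  have hlogG : Real.log (Nat.card G) ≤
      Real.log m + m * d * (2 * Real.log 2 + 2 * (Real.log c + Real.log m)) := by
    have h : (Nat.card G : ℝ) ≤ m * (4 * (c * m) ^ 2) ^ (m * d) := by exact_mod_cast hcard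
    refine (Real.log_le_log (by exact_mod_cast Nat.card_pos) h).trans_eq ?_
    rw [Real.log_mul (by positivity) (by positivity), Real.log_pow,
      Real.log_mul (by positivity) (by positivity), Real.log_pow,
      Real.log_mul (by positivity) (by positivity), hlog4]
    push_cast
    ring
  have hinv : 1.44 ≤ 1 / Real.log 2 := by
    rw [le_div_iff₀ h2pos]; linarith
  have hdiv : 1.44 * Real.log A ≤ Real.log A / Real.log 2 := by
    rw [div_eq_mul_one_div, mul_comm]; exact mul_le_mul_of_nonneg_left hinv hlA0
  have hmain : Real.log m + m * d * (2 * Real.log 2 + 2 * (Real.log c + Real.log m)) ≤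
      1.01624 * d * (A + 1) * (1.44 * Real.log A + 1) := by
    rcases Nat.lt_or_ge 1 c with hc2 | hc2
    · have hl2 : Real.log 2 ≤ Real.log c :=
        Real.log_le_log (by norm_num) (by exact_mod_cast hc2)
      have hE4 : 4 * (d : ℝ) ≤ E := by
        have hmid : (d : ℝ) * 3 ≤ (d : ℝ) / (2 * Real.log 2) * (7 + Real.log c) * Real.log c := by
          rw [div_mul_eq_mul_div, div_mul_eq_mul_div, le_div_iff₀ (by positivity), mul_assoc,
            mul_assoc]
          refine mul_le_mul_of_nonneg_left ?_ (by linarith)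
          nlinarith
        have hch : (0 : ℝ) ≤ d.choose 2 := by positivity
        rw [hE]
        nlinarith
      have hlA4 : 4 * (d * Real.log c) ≤ Real.log A := by
        rw [hlA, ← mul_assoc]; exact mul_le_mul_of_nonneg_right hE4 hl0
      have hcd : Real.log c ≤ d * Real.log c := le_mul_of_one_le_left hl0 hd1
      have hlA1 : 2 ≤ Real.log A := by linarith
      have hX : 2 * Real.log 2 + 2 * (Real.log c + Real.log m) ≤ 1.44 * Real.log A + 1 := by
        linarith
      have hmd : (m : ℝ) * d ≤ A * d := mul_le_mul_of_nonneg_right hmA (by linarith)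
      calc Real.log m + m * d * (2 * Real.log 2 + 2 * (Real.log c + Real.log m))
          ≤ d * (1.44 * Real.log A + 1) + A * d * (1.44 * Real.log A + 1) := by
            refine add_le_add ?_ (mul_le_mul hmd hX (by positivity) (by positivity))
            nlinarith
        _ = d * (A + 1) * (1.44 * Real.log A + 1) := by ring
        _ ≤ 1.01624 * (d * (A + 1) * (1.44 * Real.log A + 1)) :=
            le_mul_of_one_le_left (by positivity) (by norm_num)
        _ = _ := by ring
    · obtain rfl : c = 1 := le_antisymm hc2 hc
      have hm : m = 1 := by rw [one_pow] at hmc; omega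
      subst hm
      have hA' : A = 1 := by rw [hA, Nat.cast_one, Real.one_rpow]
      rw [hA']
      simp only [Nat.cast_one, Real.log_one]
      nlinarith
  calc Real.log (Nat.card G) ≤ _ := hlogG.trans hmain
    _ ≤ 1.01624 * d * (A + 1) * (Real.log A / Real.log 2 + 1) := by
      refine mul_le_mul_of_nonneg_left (by linarith) (by positivity)
    _ ≤ _ := le_add_of_nonneg_right (by positivity)
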